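/- Let C*(θ) be the closure in operator norm of {λ(f) : f ∈ ℓ¹(ℤⁿ)} inside the bounded operators on ℓ²(ℤⁿ), where λ(f) g = f ♮ g. Then C*(θ) is simple (its only closed two-sided ideals are {0} and C*(θ)) if and only if σ is nondegenerate, i.e. for every nonzero m ∈ ℤⁿ there exists k ∈ {1, …, n} with ∏_{j=1}^n θ_{jk}^{m_j} ≠ 1. -/

import Mathlib

open scoped BigOperators
open Filter Topology

noncomputable section

/-- The cocycle σ(l,m) = ∏_{1 ≤ j < k ≤ n} θ_{k,j}^{l_k m_j}. -/
def coc {n : ℕ} (θ : Fin n → Fin n → ℂ) (l m : Fin n → ℤ) : ℂ :=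
  ∏ p ∈ Finset.univ.filter (fun p : Fin n × Fin n => p.1 < p.2), θ p.2 p.1 ^ (l p.2 * m p.1)

/-- Twisted convolution (f ♮ g)(x) = Σ_y f(y) g(x−y) σ(y, x−y). -/
def tconv {n : ℕ} (σ : (Fin n → ℤ) → (Fin n → ℤ) → ℂ) (f g : (Fin n → ℤ) → ℂ) :
    (Fin n → ℤ) → ℂ :=
  fun x => ∑' y, f y * g (x - y) * σ y (x - y)

/-- δ_y, the indicator of {y}. -/
def delta {n : ℕ} (y : Fin n → ℤ) : (Fin n → ℤ) → ℂ := fun x => if x = y then 1 else 0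

/-- ℓ²(ℤⁿ). -/
abbrev Ltwo (n : ℕ) := lp (fun _ : Fin n → ℤ => ℂ) 2

/-- The non-commutative torus C*(θ): the operator-norm closure of
{λ(f) : f ∈ ℓ¹(ℤⁿ)} in the bounded operators on ℓ²(ℤⁿ). -/
def CstarTorus {n : ℕ} (θ : Fin n → Fin n → ℂ) : Set (Ltwo n →L[ℂ] Ltwo n) :=
  closure {T : Ltwo n →L[ℂ] Ltwo n |
    ∃ f : (Fin n → ℤ) → ℂ, Summable (fun x => ‖f x‖) ∧
      ∀ (g : Ltwo n) (x : Fin n → ℤ), (T g : (Fin n → ℤ) → ℂ) x = tconv (coc θ) f (⇑g) x}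


section NoncommutativeTorus

variable {n : ℕ}

/-- The weighted translation `g ↦ (x ↦ c x * g (x - y))` of `ℓ²(ℤⁿ)`, for a unimodular
weight `c`. -/
def weightedShift (y : Fin n → ℤ) (c : (Fin n → ℤ) → ℂ) (hc : ∀ x, ‖c x‖ = 1) :
    Ltwo n →ₗᵢ[ℂ] Ltwo n where
  toFun g := ⟨fun x => c x * g (x - y), by
    have h := (memℓp_gen_iff (p := 2) (by norm_num)).1 (lp.memℓp g)
    refine (memℓp_gen_iff (by norm_num)).2 ?_
    simpa [hc, Function.comp_def] using (Equiv.subRight y).summable_iff.2 h⟩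
  map_add' g h := by ext x; exact mul_add _ _ _
  map_smul' a g := by ext x; simp [mul_left_comm]
  norm_map' g := by
    refine (Real.rpow_left_inj (norm_nonneg _) (norm_nonneg _) (z := 2) (by norm_num)).1 ?_
    have h2 : (2 : ENNReal).toReal = 2 := by norm_num
    have key := fun f : Ltwo n => lp.norm_rpow_eq_tsum (p := 2) (by norm_num) f
    rw [h2] at key
    rw [key, key]
    simpa [hc] using (Equiv.subRight y).tsum_eq fun x => ‖g x‖ ^ (2 : ℝ)

section Cocycle

variable (θ : Fin n → Fin n → ℂ)

theorem norm_coc (hUnit : ∀ j k, ‖θ j k‖ = 1) (l m : Fin n → ℤ) : ‖coc θ l m‖ = 1 := by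
  simp [coc, norm_prod, hUnit]

theorem coc_zero_left (m : Fin n → ℤ) : coc θ 0 m = 1 := by simp [coc]

theorem coc_add_left (hUnit : ∀ j k, ‖θ j k‖ = 1) (l l' m : Fin n → ℤ) :
    coc θ (l + l') m = coc θ l m * coc θ l' m := by
  have h0 : ∀ j k, θ j k ≠ 0 := fun j k h => by simpa [h] using hUnit j k
  simp only [coc, ← Finset.prod_mul_distrib]
  refine Finset.prod_congr rfl fun p _ => ?_
  rw [← zpow_add₀ (h0 _ _), Pi.add_apply, add_mul]

theorem coc_add_right (hUnit : ∀ j k, ‖θ j k‖ = 1) (l m m' : Fin n → ℤ) :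
    coc θ l (m + m') = coc θ l m * coc θ l m' := by
  have h0 : ∀ j k, θ j k ≠ 0 := fun j k h => by simpa [h] using hUnit j k
  simp only [coc, ← Finset.prod_mul_distrib]
  refine Finset.prod_congr rfl fun p _ => ?_
  rw [← zpow_add₀ (h0 _ _), Pi.add_apply, mul_add]

/-- A product over all pairs, grouped into the diagonal and the pairs `{(i, j), (j, i)}`. -/
theorem prod_prod_eq_prod_lt {M : Type*} [CommMonoid M] (h : Fin n → Fin n → M)
    (hd : ∀ i, h i i = 1) :
    ∏ j, ∏ i, h i j =
      ∏ p ∈ Finset.univ.filter (fun p : Fin n × Fin n => p.1 < p.2), h p.1 p.2 * h p.2 p.1 := by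
  rw [Finset.prod_comm, ← Fintype.prod_prod_type' (f := h), Finset.prod_mul_distrib,
    ← Finset.prod_filter_mul_prod_filter_not Finset.univ (fun p : Fin n × Fin n => p.1 < p.2)]
  congr 1
  have hsub : (Finset.univ.filter (fun p : Fin n × Fin n => p.2 < p.1)) ⊆
      Finset.univ.filter (fun p : Fin n × Fin n => ¬ p.1 < p.2) := by
    intro p; simpa using le_of_lt
  rw [← Finset.prod_subset hsub]
  · exact Finset.prod_bij' (fun p _ => p.swap) (fun p _ => p.swap) (by simp) (by simp) (by simp)
      (by simp) (by simp)
  · intro p hp hp'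
    simp only [Finset.mem_filter, Finset.mem_univ, true_and, not_lt] at hp hp'
    rw [le_antisymm hp hp', hd]

/-- The symplectic form of the cocycle `coc θ`. -/
theorem coc_swap (hUnit : ∀ j k, ‖θ j k‖ = 1) (hHerm : ∀ j k, θ k j = starRingEnd ℂ (θ j k))
    (hDiag : ∀ j, θ j j = 1) (l m : Fin n → ℤ) :
    coc θ m l = (∏ j, (∏ i, θ i j ^ m i) ^ l j) * coc θ l m := by
  have h0 : ∀ j k, θ j k ≠ 0 := fun j k h => by simpa [h] using hUnit j k
  have hinv : ∀ j k, θ j k = (θ k j)⁻¹ := fun j k => by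
    rw [hHerm k j, Complex.inv_def, Complex.normSq_eq_norm_sq, hUnit]; simp
  simp only [← Finset.prod_zpow, ← zpow_mul]
  rw [prod_prod_eq_prod_lt (fun i j => θ i j ^ (m i * l j)) (by simp [hDiag])]
  simp only [coc, ← Finset.prod_mul_distrib]
  refine Finset.prod_congr rfl fun p _ => ?_
  rw [hinv p.1 p.2, inv_zpow', mul_right_comm, ← zpow_add₀ (h0 _ _), mul_comm (l p.2)]
  simp

end Cocycle

section Operators

variable (θ : Fin n → Fin n → ℂ) (hUnit : ∀ j k, ‖θ j k‖ = 1)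

/-- The unitary `λ(δ_y)`. -/
def torusGen (y : Fin n → ℤ) : Ltwo n →L[ℂ] Ltwo n :=
  (weightedShift y (fun x => coc θ y (x - y)) fun _ => norm_coc θ hUnit _ _).toContinuousLinearMap

/-- The right regular twisted translation, which commutes with every `torusGen`. -/
def rightGen (z : Fin n → ℤ) : Ltwo n →L[ℂ] Ltwo n :=
  (weightedShift z (fun x => coc θ (x - z) z) fun _ => norm_coc θ hUnit _ _).toContinuousLinearMap

theorem torusGen_apply (y : Fin n → ℤ) (g : Ltwo n) (x : Fin n → ℤ) :
    torusGen θ hUnit y g x = coc θ y (x - y) * g (x - y) := rfl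

theorem rightGen_apply (y : Fin n → ℤ) (g : Ltwo n) (x : Fin n → ℤ) :
    rightGen θ hUnit y g x = coc θ (x - y) y * g (x - y) := rfl

theorem norm_torusGen_apply (y : Fin n → ℤ) (g : Ltwo n) : ‖torusGen θ hUnit y g‖ = ‖g‖ :=
  LinearIsometry.norm_map _ g

theorem norm_torusGen_le (y : Fin n → ℤ) : ‖torusGen θ hUnit y‖ ≤ 1 :=
  LinearIsometry.norm_toContinuousLinearMap_le _

theorem torusGen_zero : torusGen θ hUnit 0 = 1 := by
  ext g x
  simp [torusGen_apply, coc_zero_left]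

theorem torusGen_mul (y z : Fin n → ℤ) :
    torusGen θ hUnit y * torusGen θ hUnit z = coc θ y z • torusGen θ hUnit (y + z) := by
  ext g x
  simp only [mul_apply_eq_comp, smul_apply, lp.coeFn_smul,
    Pi.smul_apply, smul_eq_mul, torusGen_apply]
  obtain ⟨w, rfl⟩ : ∃ w, x = y + z + w := ⟨x - y - z, by abel⟩
  rw [show y + z + w - y = z + w by abel, show z + w - z = w by abel,
    show y + z + w - (y + z) = w by abel, coc_add_right θ hUnit, coc_add_left θ hUnit]
  ring

theorem commute_torusGen_rightGen (y z : Fin n → ℤ) :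
    Commute (torusGen θ hUnit y) (rightGen θ hUnit z) := by
  ext g x
  simp only [mul_apply_eq_comp, torusGen_apply, rightGen_apply]
  obtain ⟨w, rfl⟩ : ∃ w, x = y + z + w := ⟨x - y - z, by abel⟩
  rw [show y + z + w - y = z + w by abel, show z + w - z = w by abel,
    show y + z + w - z = y + w by abel, show y + w - y = w by abel,
    coc_add_right θ hUnit, coc_add_left θ hUnit]
  ring

theorem star_torusGen_mul_self (y : Fin n → ℤ) :
    star (torusGen θ hUnit y) * torusGen θ hUnit y = 1 :=
  (ContinuousLinearMap.norm_map_iff_adjoint_comp_self _).1 (norm_torusGen_apply θ hUnit y)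

theorem star_torusGen (y : Fin n → ℤ) :
    star (torusGen θ hUnit y) = (coc θ y (-y))⁻¹ • torusGen θ hUnit (-y) := by
  have h0 : coc θ y (-y) ≠ 0 := fun h => by simpa [h] using norm_coc θ hUnit y (-y)
  have h := torusGen_mul θ hUnit y (-y)
  rw [add_neg_cancel, torusGen_zero] at h
  have h' := congrArg (star (torusGen θ hUnit y) * ·) h
  simp only [← mul_assoc, star_torusGen_mul_self, one_mul, mul_smul_comm, mul_one] at h'
  rw [h', smul_smul, inv_mul_cancel₀ h0, one_smul]

/-- `C*(θ)` as a closed subspace. -/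
def torusSubmodule : Submodule ℂ (Ltwo n →L[ℂ] Ltwo n) :=
  (Submodule.span ℂ (Set.range (torusGen θ hUnit))).topologicalClosure

theorem torusGen_mem (y : Fin n → ℤ) : torusGen θ hUnit y ∈ torusSubmodule θ hUnit :=
  Submodule.le_topologicalClosure _ (Submodule.subset_span ⟨y, rfl⟩)

theorem coe_torusSubmodule :
    (torusSubmodule θ hUnit : Set (Ltwo n →L[ℂ] Ltwo n)) = CstarTorus θ := by
  apply Set.Subset.antisymm
  · rw [torusSubmodule, Submodule.topologicalClosure_coe]
    refine closure_mono fun T hT => ?_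
    obtain ⟨c, rfl⟩ := Finsupp.mem_span_range_iff_exists_finsupp.1 hT
    refine ⟨c, summable_of_ne_finset_zero (s := c.support) fun y hy => ?_, fun g x => ?_⟩
    · simpa using hy
    · rw [tconv, tsum_eq_sum (s := c.support) fun y hy => by
        rw [Finsupp.notMem_support_iff.1 hy]; simp]
      have := map_sum (lp.evalCLM ℂ (fun _ : Fin n → ℤ => ℂ) 2 x)
        (fun y => (c y • torusGen θ hUnit y) g) c.support
      rw [Finsupp.sum, sum_apply]
      refine this.trans (Finset.sum_congr rfl fun y _ => ?_)
      change c y * (coc θ y (x - y) * g (x - y)) = _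
      ring
  · refine closure_minimal ?_ (Submodule.isClosed_topologicalClosure _)
    rintro T ⟨f, hf, hT⟩
    have hs : Summable fun y => f y • torusGen θ hUnit y := by
      refine Summable.of_norm_bounded hf fun y => ?_
      rw [norm_smul]
      exact mul_le_of_le_one_right (norm_nonneg _) (norm_torusGen_le θ hUnit y)
    have hTs : T = ∑' y, f y • torusGen θ hUnit y := by
      ext g x
      have h1 := (hs.hasSum.mapL (ContinuousLinearMap.apply ℂ (Ltwo n) g)).mapL
        (lp.evalCLM ℂ (fun _ : Fin n → ℤ => ℂ) 2 x)
      rw [hT, tconv]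
      refine Eq.trans (tsum_congr fun y => ?_) h1.tsum_eq
      change _ = f y * (coc θ y (x - y) * g (x - y))
      ring
    rw [hTs]
    exact (Submodule.isClosed_topologicalClosure _).mem_of_tendsto hs.hasSum
      (Eventually.of_forall fun s => Submodule.sum_mem _ fun y _ =>
        Submodule.smul_mem _ _ (torusGen_mem θ hUnit y))

variable {θ hUnit}

/-- A closed property of operators, stable under linear combinations, holds on `C*(θ)` once it
holds on the generators. -/
theorem torusSubmodule_induction {p : (Ltwo n →L[ℂ] Ltwo n) → Prop}
    (hgen : ∀ y, p (torusGen θ hUnit y)) (hzero : p 0) (hadd : ∀ S T, p S → p T → p (S + T))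
    (hsmul : ∀ (c : ℂ) S, p S → p (c • S)) (hclosed : IsClosed {T | p T})
    {T : Ltwo n →L[ℂ] Ltwo n} (hT : T ∈ torusSubmodule θ hUnit) : p T := by
  let K : Submodule ℂ (Ltwo n →L[ℂ] Ltwo n) :=
    { carrier := {T | p T}
      add_mem' := fun {S T} => hadd S T
      zero_mem' := hzero
      smul_mem' := hsmul }
  have : torusSubmodule θ hUnit ≤ K :=
    Submodule.topologicalClosure_minimal _
      (Submodule.span_le.2 (by rintro _ ⟨y, rfl⟩; exact hgen y)) hclosed
  exact this hT

theorem mul_mem_torusSubmodule {S T : Ltwo n →L[ℂ] Ltwo n} (hS : S ∈ torusSubmodule θ hUnit)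
    (hT : T ∈ torusSubmodule θ hUnit) : S * T ∈ torusSubmodule θ hUnit := by
  have hc : IsClosed (torusSubmodule θ hUnit : Set (Ltwo n →L[ℂ] Ltwo n)) :=
    Submodule.isClosed_topologicalClosure _
  refine torusSubmodule_induction (p := fun S => S * T ∈ torusSubmodule θ hUnit)
    (fun y => ?_) (by simp) (fun S S' h h' => by simpa [add_mul] using add_mem h h')
    (fun c S h => by simpa using Submodule.smul_mem _ c h)
    (hc.preimage (continuous_mul_const T)) hS
  refine torusSubmodule_induction (p := fun T => torusGen θ hUnit y * T ∈ torusSubmodule θ hUnit)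
    (fun z => ?_) (by simp) (fun S S' h h' => by simpa [mul_add] using add_mem h h')
    (fun c S h => by simpa using Submodule.smul_mem _ c h)
    (hc.preimage (continuous_const_mul _)) hT
  rw [torusGen_mul]
  exact Submodule.smul_mem _ _ (torusGen_mem θ hUnit _)

theorem star_mem_torusSubmodule {S : Ltwo n →L[ℂ] Ltwo n} (hS : S ∈ torusSubmodule θ hUnit) :
    star S ∈ torusSubmodule θ hUnit := by
  have hc : IsClosed (torusSubmodule θ hUnit : Set (Ltwo n →L[ℂ] Ltwo n)) :=
    Submodule.isClosed_topologicalClosure _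
  refine torusSubmodule_induction (p := fun S => star S ∈ torusSubmodule θ hUnit)
    (fun y => ?_) (by simp) (fun S S' h h' => by simpa using add_mem h h')
    (fun c S h => by rw [star_smul]; exact Submodule.smul_mem _ _ h)
    (hc.preimage continuous_star) hS
  rw [star_torusGen]
  exact Submodule.smul_mem _ _ (torusGen_mem θ hUnit _)

/-- `δ₀` as a vector of `ℓ²(ℤⁿ)`. -/
def vacuum (n : ℕ) : Ltwo n := lp.single 2 0 1

theorem norm_vacuum : ‖vacuum n‖ = 1 := by
  simp [vacuum, lp.norm_single]

variable (θ hUnit) in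
theorem rightGen_vacuum (z : Fin n → ℤ) :
    rightGen θ hUnit z (vacuum n) = lp.single 2 z 1 := by
  ext x
  rw [rightGen_apply, vacuum, lp.single_apply, lp.single_apply]
  by_cases h : x = z
  · subst h; simp [coc_zero_left]
  · simp [h, sub_eq_zero]

/-- `δ₀` is separating for `C*(θ)`. -/
theorem eq_zero_of_apply_vacuum {S : Ltwo n →L[ℂ] Ltwo n} (hS : S ∈ torusSubmodule θ hUnit)
    (h : S (vacuum n) = 0) : S = 0 := by
  have hcomm : ∀ z, Commute S (rightGen θ hUnit z) := fun z =>
    torusSubmodule_induction (p := fun S => Commute S (rightGen θ hUnit z))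
      (fun y => commute_torusGen_rightGen θ hUnit y z) (Commute.zero_left _)
      (fun _ _ h h' => h.add_left h') (fun c _ h => h.smul_left c)
      (isClosed_eq (continuous_mul_const _) (continuous_const_mul _)) hS
  refine lp.ext_continuousLinearMap (𝕜 := ℂ) (by norm_num) fun z => ?_
  ext
  have := congrArg (fun T : Ltwo n →L[ℂ] Ltwo n => T (vacuum n)) (hcomm z).eq
  simp only [mul_apply_eq_comp, rightGen_vacuum, h, map_zero] at this
  simp [this]

theorem torusGen_mul_eq_smul (hHerm : ∀ j k, θ k j = starRingEnd ℂ (θ j k))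
    (hDiag : ∀ j, θ j j = 1) (m l : Fin n → ℤ) :
    torusGen θ hUnit m * torusGen θ hUnit l =
      (∏ j, (∏ i, θ i j ^ m i) ^ l j) • (torusGen θ hUnit l * torusGen θ hUnit m) := by
  rw [torusGen_mul, torusGen_mul, smul_smul, ← coc_swap θ hUnit hHerm hDiag, add_comm]

/-- The vector state of `δ₀`, which is the canonical trace on `C*(θ)`. -/
def vacuumState (T : Ltwo n →L[ℂ] Ltwo n) : ℂ := inner ℂ (vacuum n) (T (vacuum n))

theorem continuous_vacuumState : Continuous (vacuumState (n := n)) :=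
  continuous_const.inner (ContinuousLinearMap.apply ℂ (Ltwo n) (vacuum n)).continuous

theorem vacuumState_torusGen (m : Fin n → ℤ) :
    vacuumState (torusGen θ hUnit m) = if m = 0 then 1 else 0 := by
  rw [vacuumState, vacuum, lp.inner_single_left, torusGen_apply, lp.single_apply]
  by_cases h : m = 0
  · subst h; simp [coc_zero_left]
  · simp [h]

theorem vacuumState_star_mul_self (T : Ltwo n →L[ℂ] Ltwo n) :
    vacuumState (star T * T) = (‖T (vacuum n)‖ : ℂ) ^ 2 := by
  rw [vacuumState, mul_apply_eq_comp, ContinuousLinearMap.star_eq_adjoint,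
    ContinuousLinearMap.adjoint_inner_right, inner_self_eq_norm_sq_to_K]
  rfl

variable (θ hUnit) in
/-- The average of the conjugates of an operator by the generators in a box of side `N`. -/
def torusAverage (N : ℕ) : (Ltwo n →L[ℂ] Ltwo n) →ₗ[ℂ] (Ltwo n →L[ℂ] Ltwo n) :=
  ((N : ℂ) ^ n)⁻¹ • ∑ k ∈ Fintype.piFinset fun _ : Fin n => Finset.range N,
    LinearMap.mulLeftRight ℂ
      (star (torusGen θ hUnit fun j => (k j : ℤ)), torusGen θ hUnit fun j => (k j : ℤ))

variable (θ hUnit) in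
theorem torusAverage_apply (N : ℕ) (T : Ltwo n →L[ℂ] Ltwo n) :
    torusAverage θ hUnit N T =
      ((N : ℂ) ^ n)⁻¹ • ∑ k ∈ Fintype.piFinset fun _ : Fin n => Finset.range N,
        star (torusGen θ hUnit fun j => (k j : ℤ)) * T * torusGen θ hUnit fun j => (k j : ℤ) := by
  simp [torusAverage, LinearMap.sum_apply]

theorem norm_torusAverage_le (N : ℕ) (T : Ltwo n →L[ℂ] Ltwo n) :
    ‖torusAverage θ hUnit N T‖ ≤ ‖T‖ := by
  rw [torusAverage_apply, norm_smul]
  have hk : ∀ k : Fin n → ℤ, ‖star (torusGen θ hUnit k) * T * torusGen θ hUnit k‖ ≤ ‖T‖ := by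
    intro k
    have h1 := norm_torusGen_le θ hUnit k
    have h2 : ‖star (torusGen θ hUnit k)‖ ≤ 1 :=
      (LinearIsometryEquiv.norm_map ContinuousLinearMap.adjoint _).trans_le h1
    calc _ ≤ ‖star (torusGen θ hUnit k)‖ * ‖T‖ * ‖torusGen θ hUnit k‖ := norm_mul₃_le
      _ ≤ 1 * ‖T‖ * 1 := by gcongr
      _ = ‖T‖ := by ring
  have hs := norm_sum_le_of_le (Fintype.piFinset fun _ : Fin n => Finset.range N)
    fun k _ => hk fun j => (k j : ℤ)
  rw [Finset.sum_const, Fintype.card_piFinset_const, Finset.card_range, nsmul_eq_mul] at hs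
  refine (mul_le_mul_of_nonneg_left hs (norm_nonneg _)).trans ?_
  rw [← mul_assoc]
  refine mul_le_of_le_one_left (norm_nonneg _) ?_
  simpa using inv_mul_le_one (a := (N : ℝ) ^ n)

theorem torusAverage_torusGen (hHerm : ∀ j k, θ k j = starRingEnd ℂ (θ j k))
    (hDiag : ∀ j, θ j j = 1) (N : ℕ) (m : Fin n → ℤ) :
    torusAverage θ hUnit N (torusGen θ hUnit m) =
      (∏ j, (N : ℂ)⁻¹ * ∑ i ∈ Finset.range N, (∏ a, θ a j ^ m a) ^ i) • torusGen θ hUnit m := by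
  rw [torusAverage_apply, Finset.prod_mul_distrib, Finset.prod_univ_sum]
  simp only [mul_assoc, torusGen_mul_eq_smul hHerm hDiag m, mul_smul_comm]
  simp only [← mul_assoc, star_torusGen_mul_self, one_mul, ← Finset.sum_smul, smul_smul]
  simp

/-- The Cesàro means of the powers of a unimodular number. -/
theorem tendsto_cesaro_pow {z : ℂ} (hz : ‖z‖ = 1) :
    Tendsto (fun N : ℕ => (N : ℂ)⁻¹ * ∑ i ∈ Finset.range N, z ^ i) atTop
      (𝓝 (if z = 1 then 1 else 0)) := by
  split_ifs with h
  · refine tendsto_const_nhds.congr' ?_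
    filter_upwards [eventually_ne_atTop 0] with N hN
    have : (N : ℂ) ≠ 0 := by exact_mod_cast hN
    simp [h, this]
  · refine squeeze_zero_norm (a := fun N : ℕ => (N : ℝ)⁻¹ * (2 / ‖z - 1‖)) (fun N => ?_) ?_
    · rw [geom_sum_eq h, norm_mul, norm_div, norm_inv, Complex.norm_natCast]
      gcongr
      refine (norm_sub_le _ _).trans ?_
      rw [norm_pow, hz, one_pow, norm_one]
      norm_num
    · simpa using tendsto_inv_atTop_nhds_zero_nat (𝕜 := ℝ) |>.mul_const (2 / ‖z - 1‖)

theorem tendsto_torusAverage_torusGen (hHerm : ∀ j k, θ k j = starRingEnd ℂ (θ j k))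
    (hDiag : ∀ j, θ j j = 1)
    (hnd : ∀ m : Fin n → ℤ, m ≠ 0 → ∃ k : Fin n, (∏ j : Fin n, θ j k ^ (m j)) ≠ 1)
    (m : Fin n → ℤ) :
    Tendsto (fun N => torusAverage θ hUnit N (torusGen θ hUnit m)) atTop
      (𝓝 (vacuumState (torusGen θ hUnit m) • 1)) := by
  simp only [torusAverage_torusGen hHerm hDiag]
  have h := (tendsto_finsetProd Finset.univ fun j _ => tendsto_cesaro_pow
    (z := ∏ a, θ a j ^ m a) (by simp [norm_prod, hUnit])).smul_const (torusGen θ hUnit m)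
  convert h using 2
  rw [vacuumState_torusGen]
  split_ifs with hm
  · subst hm
    simp [torusGen_zero]
  · obtain ⟨k, hk⟩ := hnd m hm
    rw [Finset.prod_eq_zero (Finset.mem_univ k) (if_neg hk), zero_smul, zero_smul]

/-- In the nondegenerate case, averaging recovers the canonical trace. -/
theorem tendsto_torusAverage (hHerm : ∀ j k, θ k j = starRingEnd ℂ (θ j k))
    (hDiag : ∀ j, θ j j = 1)
    (hnd : ∀ m : Fin n → ℤ, m ≠ 0 → ∃ k : Fin n, (∏ j : Fin n, θ j k ^ (m j)) ≠ 1)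
    {T : Ltwo n →L[ℂ] Ltwo n} (hT : T ∈ torusSubmodule θ hUnit) :
    Tendsto (fun N => torusAverage θ hUnit N T) atTop (𝓝 (vacuumState T • 1)) := by
  refine torusSubmodule_induction
    (p := fun T => Tendsto (fun N => torusAverage θ hUnit N T) atTop (𝓝 (vacuumState T • 1)))
    (tendsto_torusAverage_torusGen hHerm hDiag hnd) (by simp [vacuumState])
    (fun S T hS hT => ?_) (fun c S hS => ?_) ?_ hT
  · simpa [vacuumState, inner_add_right, add_smul] using hS.add hT
  · simpa [vacuumState, inner_smul_right, mul_smul] using hS.const_smul c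
  · have hequi : Equicontinuous fun N T => torusAverage θ hUnit N T := by
      refine (LipschitzWith.uniformEquicontinuous _ 1 fun N => ?_).equicontinuous
      refine LipschitzWith.of_dist_le_mul fun S T => ?_
      rw [dist_eq_norm, dist_eq_norm, ← map_sub, NNReal.coe_one, one_mul]
      exact norm_torusAverage_le N _
    exact hequi.isClosed_setOfPred_tendsto (continuous_vacuumState.smul continuous_const)

/-- In the nondegenerate case, a nonzero closed ideal contains the identity. -/
theorem one_mem_of_mem_ideal (hHerm : ∀ j k, θ k j = starRingEnd ℂ (θ j k))
    (hDiag : ∀ j, θ j j = 1)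
    (hnd : ∀ m : Fin n → ℤ, m ≠ 0 → ∃ k : Fin n, (∏ j : Fin n, θ j k ^ (m j)) ≠ 1)
    {I : Set (Ltwo n →L[ℂ] Ltwo n)} (hIsub : ∀ S ∈ I, S ∈ torusSubmodule θ hUnit)
    (h0 : (0 : Ltwo n →L[ℂ] Ltwo n) ∈ I)
    (hadd : ∀ S₁ ∈ I, ∀ S₂ ∈ I, S₁ + S₂ ∈ I) (hsmul : ∀ c : ℂ, ∀ S ∈ I, c • S ∈ I)
    (hclosed : IsClosed I)
    (hideal : ∀ S ∈ I, ∀ T ∈ torusSubmodule θ hUnit, T * S ∈ I ∧ S * T ∈ I)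
    {S : Ltwo n →L[ℂ] Ltwo n} (hS : S ∈ I) (hS0 : S ≠ 0) : (1 : Ltwo n →L[ℂ] Ltwo n) ∈ I := by
  have hSS : star S * S ∈ I := (hideal S hS _ (star_mem_torusSubmodule (hIsub S hS))).1
  have hmem : vacuumState (star S * S) • (1 : Ltwo n →L[ℂ] Ltwo n) ∈ I := by
    refine hclosed.mem_of_tendsto (tendsto_torusAverage hHerm hDiag hnd (hIsub _ hSS))
      (Eventually.of_forall fun N => ?_)
    rw [torusAverage_apply]
    refine hsmul _ _ (Finset.sum_induction _ (· ∈ I) (fun a b ha hb => hadd a ha b hb) h0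
      fun k _ => ?_)
    have hU := torusGen_mem θ hUnit fun j => (k j : ℤ)
    exact (hideal _ (hideal _ hSS _ (star_mem_torusSubmodule hU)).1 _ hU).2
  have hne : vacuumState (star S * S) ≠ 0 := by
    rw [vacuumState_star_mul_self]
    have : S (vacuum n) ≠ 0 := fun h => hS0 (eq_zero_of_apply_vacuum (hIsub S hS) h)
    simpa using this
  simpa [smul_smul, hne] using hsmul (vacuumState (star S * S))⁻¹ _ hmem

theorem torusGen_pow_vacuum_apply_of_ne (m : Fin n → ℤ) (i : ℕ) (x : Fin n → ℤ)
    (hx : x ≠ i • m) : (torusGen θ hUnit m ^ i) (vacuum n) x = 0 := by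
  induction i generalizing x with
  | zero =>
    rw [zero_nsmul] at hx
    rw [pow_zero, one_apply_eq_self, vacuum, lp.single_apply_ne _ _ _ hx]
  | succ i ih =>
    rw [pow_succ', mul_apply_eq_comp, torusGen_apply, ih, mul_zero]
    rintro h
    exact hx (by rw [succ_nsmul, ← h, sub_add_cancel])

theorem orthonormal_torusGen_pow_vacuum {m : Fin n → ℤ} (hm : m ≠ 0) :
    Orthonormal ℂ fun i : ℕ => (torusGen θ hUnit m ^ i) (vacuum n) := by
  constructor
  · intro i
    induction i with
    | zero => simpa using norm_vacuum
    | succ i ih =>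
      dsimp only at ih ⊢
      rw [pow_succ', mul_apply_eq_comp, norm_torusGen_apply, ih]
  · intro i j hij
    rw [lp.inner_eq_tsum]
    refine (tsum_congr fun x => ?_).trans tsum_zero
    by_cases h : x = i • m
    · have hx : x ≠ j • m := fun h' => hij (by
        obtain ⟨a, ha⟩ := Function.ne_iff.1 hm
        have h2 := congrFun (h.symm.trans h') a
        simpa [show m a ≠ 0 from ha] using h2)
      rw [torusGen_pow_vacuum_apply_of_ne m j x hx, inner_zero_right]
    · rw [torusGen_pow_vacuum_apply_of_ne m i x h, inner_zero_left]

variable (θ hUnit) in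
/-- Approximate fixed unit vectors of `torusGen θ hUnit m`. -/
def approxFixed (m : Fin n → ℤ) (N : ℕ) : Ltwo n :=
  ((√N : ℝ) : ℂ)⁻¹ • ∑ i ∈ Finset.range N, (torusGen θ hUnit m ^ i) (vacuum n)

theorem norm_approxFixed {m : Fin n → ℤ} (hm : m ≠ 0) {N : ℕ} (hN : N ≠ 0) :
    ‖approxFixed θ hUnit m N‖ = 1 := by
  have h := (orthonormal_torusGen_pow_vacuum (θ := θ) (hUnit := hUnit) hm).inner_sum
    (fun _ => 1) (fun _ => 1) (Finset.range N)
  simp only [one_smul, map_one, mul_one, Finset.sum_const, Finset.card_range, nsmul_eq_mul] at h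
  rw [inner_self_eq_norm_sq_to_K] at h
  have h' : ‖∑ i ∈ Finset.range N, (torusGen θ hUnit m ^ i) (vacuum n)‖ ^ 2 = (N : ℝ) := by
    exact Complex.ofReal_injective (by simpa using h)
  have hpos : (0 : ℝ) < √N := Real.sqrt_pos.2 (by positivity)
  rw [approxFixed, norm_smul, norm_inv, Complex.norm_real, Real.norm_of_nonneg hpos.le, ← h',
    Real.sqrt_sq (norm_nonneg _), inv_mul_cancel₀]
  intro h0
  rw [h0] at h'
  exact hN (by simpa using h'.symm)

theorem norm_approxFixed_le {m : Fin n → ℤ} (hm : m ≠ 0) (N : ℕ) :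
    ‖approxFixed θ hUnit m N‖ ≤ 1 := by
  rcases eq_or_ne N 0 with rfl | hN
  · simp [approxFixed]
  · exact (norm_approxFixed hm hN).le

theorem tendsto_torusGen_sub_one_approxFixed {m : Fin n → ℤ} (hm : m ≠ 0) :
    Tendsto (fun N => (torusGen θ hUnit m - 1) (approxFixed θ hUnit m N)) atTop (𝓝 0) := by
  have hv := (orthonormal_torusGen_pow_vacuum (θ := θ) (hUnit := hUnit) hm).1
  refine squeeze_zero_norm (a := fun N : ℕ => (√N)⁻¹ * 2) (fun N => ?_) ?_
  · have htel : (torusGen θ hUnit m - 1)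
        (∑ i ∈ Finset.range N, (torusGen θ hUnit m ^ i) (vacuum n)) =
        (torusGen θ hUnit m ^ N) (vacuum n) - (torusGen θ hUnit m ^ 0) (vacuum n) := by
      rw [← Finset.sum_range_sub (fun i => (torusGen θ hUnit m ^ i) (vacuum n)), map_sum]
      refine Finset.sum_congr rfl fun i _ => ?_
      rw [pow_succ', mul_apply_eq_comp]
      rfl
    rw [approxFixed, map_smul, htel, norm_smul, norm_inv, Complex.norm_real,
      Real.norm_of_nonneg (Real.sqrt_nonneg _)]
    gcongr
    refine (norm_sub_le _ _).trans ?_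
    rw [hv, hv]
    norm_num
  · have := (Real.tendsto_sqrt_atTop.comp tendsto_natCast_atTop_atTop).inv_tendsto_atTop
    simpa using this.mul_const 2

variable (θ hUnit) in
/-- The ideal of elements of `C*(θ)` all of whose right multiples vanish asymptotically on
`approxFixed θ hUnit m`. -/
def asymptoticKernel (m : Fin n → ℤ) : Set (Ltwo n →L[ℂ] Ltwo n) :=
  {S | S ∈ torusSubmodule θ hUnit ∧ ∀ T ∈ torusSubmodule θ hUnit,
    Tendsto (fun N => S (T (approxFixed θ hUnit m N))) atTop (𝓝 0)}

theorem isClosed_asymptoticKernel {m : Fin n → ℤ} (hm : m ≠ 0) :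
    IsClosed (asymptoticKernel θ hUnit m) := by
  have hset : asymptoticKernel θ hUnit m = (torusSubmodule θ hUnit : Set _) ∩
      ⋂ T ∈ torusSubmodule θ hUnit,
        {S | Tendsto (fun N => S (T (approxFixed θ hUnit m N))) atTop (𝓝 0)} := by
    ext S
    simp [asymptoticKernel]
  rw [hset]
  refine IsClosed.inter (Submodule.isClosed_topologicalClosure _)
    (isClosed_iInter fun T => isClosed_iInter fun _ => ?_)
  have hequi : Equicontinuous fun (N : ℕ) (S : Ltwo n →L[ℂ] Ltwo n) =>
      S (T (approxFixed θ hUnit m N)) := by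
    refine (LipschitzWith.uniformEquicontinuous _ ‖T‖₊ fun N => ?_).equicontinuous
    refine LipschitzWith.of_dist_le_mul fun S S' => ?_
    rw [dist_eq_norm, dist_eq_norm, ← sub_apply, coe_nnnorm, mul_comm]
    refine (ContinuousLinearMap.le_opNorm _ _).trans ?_
    gcongr
    exact (T.le_opNorm _).trans
      (mul_le_of_le_one_right (norm_nonneg _) (norm_approxFixed_le hm N))
  exact hequi.isClosed_setOfPred_tendsto continuous_const

theorem one_notMem_asymptoticKernel {m : Fin n → ℤ} (hm : m ≠ 0) :
    (1 : Ltwo n →L[ℂ] Ltwo n) ∉ asymptoticKernel θ hUnit m := by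
  rintro ⟨h1, h⟩
  have h2 : Tendsto (fun N => ‖approxFixed θ hUnit m N‖) atTop (𝓝 0) := by
    simpa using (h 1 h1).norm
  refine zero_ne_one (tendsto_nhds_unique h2 (tendsto_const_nhds.congr' ?_))
  filter_upwards [eventually_ne_atTop 0] with N hN
  exact (norm_approxFixed hm hN).symm

theorem one_mem_torusSubmodule : (1 : Ltwo n →L[ℂ] Ltwo n) ∈ torusSubmodule θ hUnit := by
  simpa [torusGen_zero] using torusGen_mem θ hUnit 0

theorem torusGen_sub_one_mem_asymptoticKernel (hHerm : ∀ j k, θ k j = starRingEnd ℂ (θ j k))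
    (hDiag : ∀ j, θ j j = 1) {m : Fin n → ℤ} (hm : m ≠ 0)
    (hdeg : ∀ k : Fin n, (∏ j : Fin n, θ j k ^ (m j)) = 1) :
    torusGen θ hUnit m - 1 ∈ asymptoticKernel θ hUnit m := by
  refine ⟨sub_mem (torusGen_mem θ hUnit m) one_mem_torusSubmodule, fun T hT => ?_⟩
  have hcomm : Commute (torusGen θ hUnit m - 1) T :=
    torusSubmodule_induction (p := fun T => Commute (torusGen θ hUnit m - 1) T)
      (fun l => Commute.sub_left
        (by simpa [hdeg] using! torusGen_mul_eq_smul (hUnit := hUnit) hHerm hDiag m l)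
        (Commute.one_left _))
      (Commute.zero_right _) (fun _ _ h h' => h.add_right h') (fun c _ h => h.smul_right c)
      (isClosed_eq (continuous_const_mul _) (continuous_mul_const _)) hT
  have h := (T.continuous.tendsto 0).comp
    (tendsto_torusGen_sub_one_approxFixed (θ := θ) (hUnit := hUnit) hm)
  rw [map_zero] at h
  refine h.congr fun N => ?_
  rw [Function.comp_apply, ← mul_apply_eq_comp, ← hcomm.eq, mul_apply_eq_comp]

theorem torusGen_sub_one_ne_zero {m : Fin n → ℤ} (hm : m ≠ 0) :
    torusGen θ hUnit m - 1 ≠ 0 := by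
  intro h
  have h1 := vacuumState_torusGen (θ := θ) (hUnit := hUnit) m
  have h2 := vacuumState_torusGen (θ := θ) (hUnit := hUnit) 0
  rw [sub_eq_zero.1 h, ← torusGen_zero θ hUnit, h2] at h1
  simp [hm] at h1

end Operators

end NoncommutativeTorus

/-- C*(θ) is simple — every operator-norm-closed two-sided ideal of it
is {0} or everything — if and only if the cocycle σ is nondegenerate, i.e. for every
nonzero m ∈ ℤⁿ there is k with ∏_j θ_{jk}^{m_j} ≠ 1. -/
theorem statement15 {n : ℕ} (θ : Fin n → Fin n → ℂ)
    (hUnit : ∀ j k, ‖θ j k‖ = 1)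
    (hHerm : ∀ j k, θ k j = starRingEnd ℂ (θ j k))
    (hDiag : ∀ j, θ j j = 1) :
    (∀ I : Set (Ltwo n →L[ℂ] Ltwo n),
        I ⊆ CstarTorus θ →
        (0 : Ltwo n →L[ℂ] Ltwo n) ∈ I →
        (∀ S₁ ∈ I, ∀ S₂ ∈ I, S₁ + S₂ ∈ I) →
        (∀ c : ℂ, ∀ S ∈ I, c • S ∈ I) →
        IsClosed I →
        (∀ S ∈ I, ∀ T ∈ CstarTorus θ, T.comp S ∈ I ∧ S.comp T ∈ I) →
        (I = {0} ∨ I = CstarTorus θ))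
    ↔ (∀ m : Fin n → ℤ, m ≠ 0 → ∃ k : Fin n, (∏ j : Fin n, θ j k ^ (m j)) ≠ 1) := by
  have hC := coe_torusSubmodule θ hUnit
  have hmem : ∀ S, S ∈ CstarTorus θ ↔ S ∈ torusSubmodule θ hUnit := fun S => by rw [← hC]; rfl
  constructor
  · intro hsimple m hm
    by_contra! hdeg
    have hgen := torusGen_sub_one_mem_asymptoticKernel (hUnit := hUnit) hHerm hDiag hm hdeg
    have hideal : ∀ S ∈ asymptoticKernel θ hUnit m, ∀ T ∈ CstarTorus θ,
        T.comp S ∈ asymptoticKernel θ hUnit m ∧ S.comp T ∈ asymptoticKernel θ hUnit m := by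
      intro S hS T hT
      rw [hmem] at hT
      refine ⟨⟨mul_mem_torusSubmodule hT hS.1, fun R hR => ?_⟩,
        ⟨mul_mem_torusSubmodule hS.1 hT, fun R hR => hS.2 _ (mul_mem_torusSubmodule hT hR)⟩⟩
      have h := (T.continuous.tendsto 0).comp (hS.2 R hR)
      rwa [map_zero] at h
    rcases hsimple (asymptoticKernel θ hUnit m) (fun S hS => (hmem S).2 hS.1)
      ⟨zero_mem _, fun T _ => by simp⟩
      (fun S₁ h₁ S₂ h₂ => ⟨add_mem h₁.1 h₂.1, fun T hT => by
        simpa using (h₁.2 T hT).add (h₂.2 T hT)⟩)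
      (fun c S h => ⟨Submodule.smul_mem _ c h.1, fun T hT => by
        simpa using (h.2 T hT).const_smul c⟩)
      (isClosed_asymptoticKernel hm)
      hideal with h | h
    · rw [h] at hgen
      exact torusGen_sub_one_ne_zero hm hgen
    · exact one_notMem_asymptoticKernel hm (h ▸ (hmem 1).2 one_mem_torusSubmodule)
  · intro hnd I hsub h0 hadd hsmul hclosed hideal
    refine or_iff_not_imp_left.2 fun hI => hsub.antisymm fun T hT => ?_
    obtain ⟨S, hS, hS0⟩ : ∃ S ∈ I, S ≠ 0 := by
      by_contra! h
      exact hI (Set.Subset.antisymm h (Set.singleton_subset_iff.2 h0))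
    have hone := one_mem_of_mem_ideal hHerm hDiag hnd (fun S hS => (hmem S).1 (hsub hS)) h0 hadd
      hsmul hclosed (fun S hS T hT => hideal S hS T ((hmem T).2 hT)) hS hS0
    exact (hideal 1 hone T hT).1
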